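/- arXiv:2006.00902 — 3 statements merged into one kernel-verified Lean document; each statement's English description precedes it below -/
import Mathlib

section
/- Let δ > 0, suppose p ≥ d + 1, and let S ∈ St(d,p)^{⊗n} be a second-order critical point of f satisfying the proximity condition d_F(S,Z) ≤ δ√(d/n)·‖Δ‖_op. Then: (i) for every i, the smallest eigenvalue of Λ_{ii}(S) satisfies λ_min(Λ_{ii}(S)) ≥ n − δ²d‖Δ‖_op²/(2n) − max_{1≤k≤n}‖Σ_{j≠k} Δ_{kj} S_j‖_op; and (ii) max_{1≤i≤n}‖Σ_{j≠i} Δ_{ij} S_j‖_op ≤ δ√(d/n)·‖Δ‖_op·max_{1≤i≤n}‖Δ_i‖_op + max_{1≤i≤n}‖Δ_iᵀZ‖_op. -/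
open Matrix MeasureTheory ProbabilityTheory
open scoped BigOperators ENNReal

noncomputable section

/-- Frobenius inner product `⟨X, Y⟩ = Tr (X Yᵀ)`. -/
def finner {m k : Type*} [Fintype m] [Fintype k] (X Y : Matrix m k ℝ) : ℝ :=
  ∑ i, ∑ j, X i j * Y i j

/-- Frobenius norm. -/
def frobNorm {m k : Type*} [Fintype m] [Fintype k] (X : Matrix m k ℝ) : ℝ :=
  Real.sqrt (∑ i, ∑ j, (X i j) ^ 2)

/-- Spectral (ℓ²-operator) norm of a real matrix. -/
def opNorm {m k : Type*} [Fintype m] [Fintype k] [DecidableEq k] (X : Matrix m k ℝ) : ℝ :=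
  ‖LinearMap.toContinuousLinearMap (Matrix.toEuclideanLin X)‖

/-- The `(i,j)` d×d block of an (nd)×(nd) matrix. -/
def blk {n d : ℕ} (M : Matrix (Fin n × Fin d) (Fin n × Fin d) ℝ) (i j : Fin n) :
    Matrix (Fin d) (Fin d) ℝ := fun k l => M (i, k) (j, l)

/-- The i-th d×p block row of an (nd)×p matrix. -/
def rowBlk {n d p : ℕ} (S : Matrix (Fin n × Fin d) (Fin p) ℝ) (i : Fin n) :
    Matrix (Fin d) (Fin p) ℝ := fun k l => S (i, k) l

/-- The i-th (nd)×d block column of an (nd)×(nd) matrix. -/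
def colBlk {n d : ℕ} (M : Matrix (Fin n × Fin d) (Fin n × Fin d) ℝ) (i : Fin n) :
    Matrix (Fin n × Fin d) (Fin d) ℝ := fun q l => M q (i, l)

/-- All d×p block rows lie in the Stiefel manifold St(d,p) (for p = d: are orthogonal). -/
def StiefelBlocks {n d p : ℕ} (S : Matrix (Fin n × Fin d) (Fin p) ℝ) : Prop :=
  ∀ i, rowBlk S i * (rowBlk S i)ᵀ = 1

/-- The vertical stack Z of n copies of the identity I_d. -/
def Zmat (n d : ℕ) : Matrix (Fin n × Fin d) (Fin d) ℝ := fun q l => if q.2 = l then 1 else 0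

/-- Feasibility for the SDP relaxation: symmetric, PSD, identity diagonal blocks. -/
def sdpFeasible {n d : ℕ} (X : Matrix (Fin n × Fin d) (Fin n × Fin d) ℝ) : Prop :=
  X.IsSymm ∧ X.PosSemidef ∧ ∀ i, blk X i i = 1

/-- Global maximizer of the SDP relaxation with data `A`. -/
def sdpMaximizer {n d : ℕ} (A X : Matrix (Fin n × Fin d) (Fin n × Fin d) ℝ) : Prop :=
  sdpFeasible X ∧ ∀ Y, sdpFeasible Y → finner A Y ≤ finner A X

/-- Global maximizer of the program (P) with data `A`. -/
def progPMaximizer {n d : ℕ} (A : Matrix (Fin n × Fin d) (Fin n × Fin d) ℝ)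
    (R : Matrix (Fin n × Fin d) (Fin d) ℝ) : Prop :=
  StiefelBlocks R ∧
    ∀ R' : Matrix (Fin n × Fin d) (Fin d) ℝ, StiefelBlocks R' →
      finner A (R' * R'ᵀ) ≤ finner A (R * Rᵀ)

/-- The distance `d_F(S, Z) = min_{Q ∈ St(d,p)} ‖S − ZQ‖_F`. -/
def dF {n d p : ℕ} (S : Matrix (Fin n × Fin d) (Fin p) ℝ) : ℝ :=
  sInf {c | ∃ Q : Matrix (Fin d) (Fin p) ℝ, Q * Qᵀ = 1 ∧ c = frobNorm (S - Zmat n d * Q)}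

/-- `Λ_{ii}(S) = (1/2) Σ_j (S_i S_jᵀ A_{ji} + A_{ij} S_j S_iᵀ)`. -/
def Lam {n d p : ℕ} (A : Matrix (Fin n × Fin d) (Fin n × Fin d) ℝ)
    (S : Matrix (Fin n × Fin d) (Fin p) ℝ) (i : Fin n) : Matrix (Fin d) (Fin d) ℝ :=
  (1 / 2 : ℝ) •
    ∑ j, (rowBlk S i * (rowBlk S j)ᵀ * blk A j i + blk A i j * rowBlk S j * (rowBlk S i)ᵀ)

/-- Block diagonal matrix with given d×d diagonal blocks. -/
def blkDiag {n d : ℕ} (D : Fin n → Matrix (Fin d) (Fin d) ℝ) :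
    Matrix (Fin n × Fin d) (Fin n × Fin d) ℝ :=
  fun q r => if q.1 = r.1 then D q.1 q.2 r.2 else 0

/-- Local maximizer of `f(S) = ⟨A, S Sᵀ⟩` over `St(d,p)^{⊗n}`. -/
def isLocalMax {n d p : ℕ} (A : Matrix (Fin n × Fin d) (Fin n × Fin d) ℝ)
    (S : Matrix (Fin n × Fin d) (Fin p) ℝ) : Prop :=
  StiefelBlocks S ∧ ∃ ε > (0 : ℝ), ∀ S' : Matrix (Fin n × Fin d) (Fin p) ℝ,
    StiefelBlocks S' → frobNorm (S' - S) < ε → finner A (S' * S'ᵀ) ≤ finner A (S * Sᵀ)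

/-- First-order criticality: `Σ_j A_{ij} S_j = Λ_{ii}(S) S_i` for all i. -/
def firstOrderCrit {n d p : ℕ} (A : Matrix (Fin n × Fin d) (Fin n × Fin d) ℝ)
    (S : Matrix (Fin n × Fin d) (Fin p) ℝ) : Prop :=
  ∀ i, (∑ j, blk A i j * rowBlk S j) = Lam A S i * rowBlk S i

/-- Second-order necessary inequality over tangent directions. -/
def secondOrderIneq {n d p : ℕ} (A : Matrix (Fin n × Fin d) (Fin n × Fin d) ℝ)
    (S : Matrix (Fin n × Fin d) (Fin p) ℝ) : Prop :=
  ∀ Y : Matrix (Fin n × Fin d) (Fin p) ℝ,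
    (∀ i, rowBlk S i * (rowBlk Y i)ᵀ + rowBlk Y i * (rowBlk S i)ᵀ = 0) →
    ∑ i, ∑ j, finner (blk A i j) (rowBlk Y i * (rowBlk Y j)ᵀ) ≤
      ∑ i, finner (Lam A S i) (rowBlk Y i * (rowBlk Y i)ᵀ)

/-- Second-order critical point of `f`. -/
def secondOrderCrit {n d p : ℕ} (A : Matrix (Fin n × Fin d) (Fin n × Fin d) ℝ)
    (S : Matrix (Fin n × Fin d) (Fin p) ℝ) : Prop :=
  StiefelBlocks S ∧ firstOrderCrit A S ∧ secondOrderIneq A S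

/-- Partial trace `Tr_d(Δ) ∈ ℝ^{n×n}`. -/
def partialTrace {n d : ℕ} (Δ : Matrix (Fin n × Fin d) (Fin n × Fin d) ℝ) :
    Matrix (Fin n) (Fin n) ℝ := fun i j => (blk Δ i j).trace

/-- Singular values of a d×p real matrix (square roots of the eigenvalues of `M Mᴴ`). -/
def singVals {d p : ℕ} (M : Matrix (Fin d) (Fin p) ℝ) (i : Fin d) : ℝ :=
  Real.sqrt ((Matrix.isHermitian_mul_conjTranspose_self M).eigenvalues i)

/-- Nuclear norm: sum of singular values. -/
def nuclearNorm {d p : ℕ} (M : Matrix (Fin d) (Fin p) ℝ) : ℝ :=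
  ∑ i, singVals M i

/-- The law of the iid standard Gaussian coordinates indexing the noise. -/
def gaussianEnsemble (n d : ℕ) :
    Measure (((Fin n × Fin d) × (Fin n × Fin d)) → ℝ) :=
  Measure.pi fun _ => gaussianReal 0 1

/-- The symmetric Gaussian random matrix `W` built from the iid coordinates:
`W_{ii} = 0`, the entries of `W_{ij}` for `i < j` are iid standard Gaussians, and
`W_{ji} = W_{ij}ᵀ`. -/
def Wof {n d : ℕ} (ω : ((Fin n × Fin d) × (Fin n × Fin d)) → ℝ) :
    Matrix (Fin n × Fin d) (Fin n × Fin d) ℝ :=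
  fun q r => if q.1 < r.1 then ω (q, r) else if r.1 < q.1 then ω (r, q) else 0

theorem frobNorm_sq {m k : Type*} [Fintype m] [Fintype k] (X : Matrix m k ℝ) :
    frobNorm X ^ 2 = ∑ i, ∑ j, X i j ^ 2 :=
  Real.sq_sqrt (by positivity)

section OpNorm

variable {m k : Type*} [Fintype m] [Fintype k] [DecidableEq k]

theorem opNorm_nonneg (X : Matrix m k ℝ) : 0 ≤ opNorm X := norm_nonneg _

open scoped Matrix.Norms.L2Operator in
theorem opNorm_eq_l2_opNorm (X : Matrix m k ℝ) : opNorm X = ‖X‖ := rfl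

theorem opNorm_add_le (X Y : Matrix m k ℝ) : opNorm (X + Y) ≤ opNorm X + opNorm Y := by
  simp only [opNorm, map_add]
  exact norm_add_le _ _

theorem opNorm_mul_le {l : Type*} [Fintype l] [DecidableEq l] (X : Matrix m k ℝ)
    (Y : Matrix k l ℝ) : opNorm (X * Y) ≤ opNorm X * opNorm Y := by
  simp only [opNorm_eq_l2_opNorm]
  exact l2_opNorm_mul X Y

theorem opNorm_transpose [DecidableEq m] (X : Matrix m k ℝ) : opNorm Xᵀ = opNorm X := by
  simp only [opNorm_eq_l2_opNorm]
  rw [← conjTranspose_eq_transpose_of_trivial, l2_opNorm_conjTranspose]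

theorem opNorm_one_le : opNorm (1 : Matrix k k ℝ) ≤ 1 := by
  refine ContinuousLinearMap.opNorm_le_bound _ zero_le_one fun v => ?_
  simp

theorem opNorm_le_one_of_mul_transpose_eq_one [DecidableEq m] {Q : Matrix m k ℝ}
    (hQ : Q * Qᵀ = 1) : opNorm Q ≤ 1 := by
  have h : opNorm Q * opNorm Q ≤ 1 := by
    have h₁ : opNorm (Q * Qᵀ) = opNorm Qᵀ * opNorm Qᵀ := by
      simp only [opNorm_eq_l2_opNorm]
      simpa [conjTranspose_eq_transpose_of_trivial] using l2_opNorm_conjTranspose_mul_self Qᵀ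
    rw [← opNorm_transpose, ← h₁, hQ]
    exact opNorm_one_le
  nlinarith [opNorm_nonneg Q]

theorem abs_dotProduct_mulVec_le (X : Matrix m k ℝ) {u : m → ℝ} {v : k → ℝ}
    (hu : u ⬝ᵥ u = 1) (hv : v ⬝ᵥ v = 1) : |u ⬝ᵥ X *ᵥ v| ≤ opNorm X := by
  have hu' : ‖WithLp.toLp 2 u‖ = 1 := by
    rw [EuclideanSpace.norm_eq, Real.sqrt_eq_one, ← hu]
    simp [dotProduct, sq]
  have hv' : ‖WithLp.toLp 2 v‖ = 1 := by
    rw [EuclideanSpace.norm_eq, Real.sqrt_eq_one, ← hv]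
    simp [dotProduct, sq]
  have h₁ := (LinearMap.toContinuousLinearMap (toEuclideanLin X)).le_opNorm (WithLp.toLp 2 v)
  have h₂ := abs_real_inner_le_norm (WithLp.toLp 2 u) (WithLp.toLp 2 (X *ᵥ v))
  rw [EuclideanSpace.inner_toLp_toLp, hu', one_mul] at h₂
  rw [hv', mul_one] at h₁
  have h₃ : (X *ᵥ v) ⬝ᵥ star u = u ⬝ᵥ X *ᵥ v := by
    rw [dotProduct_comm, star_trivial]
  rw [h₃] at h₂
  exact h₂.trans h₁

theorem opNorm_le_frobNorm (X : Matrix m k ℝ) : opNorm X ≤ frobNorm X := by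
  refine ContinuousLinearMap.opNorm_le_bound _ (Real.sqrt_nonneg _) fun v => ?_
  rw [EuclideanSpace.norm_eq, EuclideanSpace.norm_eq, frobNorm,
    ← Real.sqrt_mul (by positivity), Finset.sum_mul]
  refine Real.sqrt_le_sqrt (Finset.sum_le_sum fun i _ => ?_)
  simpa [mulVec, dotProduct] using
    Finset.sum_mul_sq_le_sq_mul_sq Finset.univ (X i) (fun j => v j)

end OpNorm

/-- A symmetric matrix whose unit eigenvectors all have eigenvalue at least `β` dominates `β`. -/
theorem mul_sum_sq_le_of_eigenvalue_ge {ι : Type*} [Fintype ι] [DecidableEq ι]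
    {M : Matrix ι ι ℝ} (hM : M.IsSymm) {β : ℝ}
    (h : ∀ (y : ι → ℝ) (c : ℝ), y ⬝ᵥ y = 1 → M *ᵥ y = c • y → β ≤ c) (x : ι → ℝ) :
    β * ∑ m, x m ^ 2 ≤ x ⬝ᵥ M *ᵥ x := by
  have hN : (M - β • 1).IsHermitian := by
    rw [IsHermitian, conjTranspose_eq_transpose_of_trivial]
    simp [hM.eq]
  have hpos : (M - β • 1).PosSemidef := by
    refine hN.posSemidef_iff_eigenvalues_nonneg.2 fun i => ?_
    have hv := hN.mulVec_eigenvectorBasis i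
    set v : ι → ℝ := (hN.eigenvectorBasis i).ofLp with hvdef
    have h₁ : v ⬝ᵥ v = 1 := by
      have := hN.eigenvectorBasis.orthonormal.1 i
      rw [EuclideanSpace.norm_eq, Real.sqrt_eq_one] at this
      rw [← this]
      simp [dotProduct, sq, hvdef]
    have h₂ : M *ᵥ v = (hN.eigenvalues i + β) • v := by
      rw [sub_mulVec, smul_mulVec, one_mulVec, sub_eq_iff_eq_add] at hv
      rw [hv, add_smul]
    have := h v _ h₁ h₂
    simpa using this
  have := hpos.re_dotProduct_nonneg x
  rw [star_trivial, sub_mulVec, smul_mulVec, one_mulVec, dotProduct_sub, dotProduct_smul] at this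
  simp only [RCLike.re_to_real, sub_nonneg, smul_eq_mul] at this
  simpa [dotProduct, sq] using this

section Blocks

variable {n d p : ℕ}

theorem blk_Zmat_mul_transpose_add (Δ : Matrix (Fin n × Fin d) (Fin n × Fin d) ℝ) (i j : Fin n) :
    blk (Zmat n d * (Zmat n d)ᵀ + Δ) i j = 1 + blk Δ i j := by
  ext a b
  simp [blk, Zmat, mul_apply, one_apply]

theorem blk_transpose_of_isSymm {M : Matrix (Fin n × Fin d) (Fin n × Fin d) ℝ} (hM : M.IsSymm)
    (i j : Fin n) : (blk M i j)ᵀ = blk M j i := by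
  ext a b
  exact hM.apply _ _

theorem rowBlk_sub_Zmat_mul (S : Matrix (Fin n × Fin d) (Fin p) ℝ) (Q : Matrix (Fin d) (Fin p) ℝ)
    (j : Fin n) : rowBlk (S - Zmat n d * Q) j = rowBlk S j - Q := by
  ext a b
  simp [rowBlk, Zmat, mul_apply]

theorem sum_erase_blk_mul_rowBlk {M : Matrix (Fin n × Fin d) (Fin n × Fin d) ℝ} (hM : M.IsSymm)
    (hdiag : ∀ i, blk M i i = 0) (S : Matrix (Fin n × Fin d) (Fin p) ℝ) (i : Fin n) :
    ∑ j ∈ Finset.univ.erase i, blk M i j * rowBlk S j = (colBlk M i)ᵀ * S := by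
  have h : ∑ j ∈ Finset.univ.erase i, blk M i j * rowBlk S j = ∑ j, blk M i j * rowBlk S j :=
    Finset.sum_erase _ (by rw [hdiag, Matrix.zero_mul])
  rw [h]
  ext a b
  simp only [Matrix.sum_apply, mul_apply, transpose_apply, colBlk, blk, rowBlk, Fintype.sum_prod_type]
  exact Finset.sum_congr rfl fun j _ => Finset.sum_congr rfl fun c _ => by rw [hM.apply]

theorem Lam_isSymm {A : Matrix (Fin n × Fin d) (Fin n × Fin d) ℝ} (hA : A.IsSymm)
    (S : Matrix (Fin n × Fin d) (Fin p) ℝ) (i : Fin n) : (Lam A S i).IsSymm := by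
  rw [IsSymm, Lam, transpose_smul, transpose_sum]
  congr 1
  refine Finset.sum_congr rfl fun j _ => ?_
  simp only [transpose_add, transpose_mul, transpose_transpose, blk_transpose_of_isSymm hA]
  rw [add_comm, Matrix.mul_assoc, Matrix.mul_assoc]

theorem le_dF (hn : 0 < n) {S : Matrix (Fin n × Fin d) (Fin p) ℝ} (hS : StiefelBlocks S) {g : ℝ}
    (h : ∀ Q : Matrix (Fin d) (Fin p) ℝ, Q * Qᵀ = 1 → g ≤ frobNorm (S - Zmat n d * Q)) :
    g ≤ dF S := by
  refine le_csInf ⟨_, rowBlk S ⟨0, hn⟩, hS _, rfl⟩ ?_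
  rintro _ ⟨Q, hQ, rfl⟩
  exact h Q hQ

theorem sum_vecMul_rowBlk_sq_le_frobNorm_sq (D : Matrix (Fin n × Fin d) (Fin p) ℝ)
    {y : Fin d → ℝ} (hy : y ⬝ᵥ y = 1) :
    ∑ j, (y ᵥ* rowBlk D j) ⬝ᵥ (y ᵥ* rowBlk D j) ≤ frobNorm D ^ 2 := by
  rw [frobNorm_sq, Fintype.sum_prod_type]
  refine Finset.sum_le_sum fun j _ => ?_
  rw [Finset.sum_comm]
  refine Finset.sum_le_sum fun l _ => ?_
  have h := Finset.sum_mul_sq_le_sq_mul_sq Finset.univ y (fun a => D (j, a) l)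
  have hy' : ∑ a, y a ^ 2 = 1 := by simpa [dotProduct, sq] using hy
  rw [hy', one_mul] at h
  simpa [vecMul, dotProduct, rowBlk, sq] using h

theorem vecMul_dotProduct_vecMul_self {Q : Matrix (Fin d) (Fin p) ℝ} (hQ : Q * Qᵀ = 1)
    (y : Fin d → ℝ) : (y ᵥ* Q) ⬝ᵥ (y ᵥ* Q) = y ⬝ᵥ y := by
  rw [← dotProduct_mulVec, ← mulVec_transpose, mulVec_mulVec, hQ, one_mulVec]

theorem finner_vecMulVec_mul_transpose (M : Matrix (Fin d) (Fin d) ℝ) (x : Fin d → ℝ)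
    (u : Fin p → ℝ) :
    finner M (vecMulVec x u * (vecMulVec x u)ᵀ) = (x ⬝ᵥ M *ᵥ x) * (u ⬝ᵥ u) := by
  have h : vecMulVec x u * (vecMulVec x u)ᵀ = (u ⬝ᵥ u) • vecMulVec x x := by
    ext a b
    simp only [mul_apply, vecMulVec_apply, transpose_apply, Matrix.smul_apply, smul_eq_mul, dotProduct,
      Finset.sum_mul]
    exact Finset.sum_congr rfl fun _ _ => by ring
  rw [h]
  generalize u ⬝ᵥ u = c
  simp only [finner, Matrix.smul_apply, vecMulVec_apply, smul_eq_mul, dotProduct, mulVec,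
    Finset.mul_sum, Finset.sum_mul]
  exact Finset.sum_congr rfl fun _ _ => Finset.sum_congr rfl fun _ _ => by ring

theorem Lam_quadratic_form_nonneg {A : Matrix (Fin n × Fin d) (Fin n × Fin d) ℝ}
    {S : Matrix (Fin n × Fin d) (Fin p) ℝ} (hp : d < p) (hS : secondOrderIneq A S) {i : Fin n}
    (hAi : blk A i i = 1) (x : Fin d → ℝ) : 0 ≤ x ⬝ᵥ Lam A S i *ᵥ x := by
  obtain ⟨u, hu, hu0⟩ := (Submodule.ne_bot_iff _).1
    (LinearMap.ker_ne_bot_of_finrank_lt (f := (rowBlk S i).mulVecLin) (by simpa using hp))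
  have hSu : rowBlk S i *ᵥ u = 0 := hu
  let Y : Matrix (Fin n × Fin d) (Fin p) ℝ := fun q l => if q.1 = i then x q.2 * u l else 0
  have hYi : rowBlk Y i = vecMulVec x u := by
    ext a b
    simp [rowBlk, Y, vecMulVec_apply]
  have hYj : ∀ j, j ≠ i → rowBlk Y j = 0 := fun j hj => by
    ext a b
    simp [rowBlk, Y, hj]
  have key := hS Y fun j => by
    rcases eq_or_ne j i with rfl | hj
    · have h : rowBlk S j * (rowBlk Y j)ᵀ = 0 := by
        rw [hYi, transpose_vecMulVec, mul_vecMulVec, hSu, zero_vecMulVec]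
      have h' : rowBlk Y j * (rowBlk S j)ᵀ = 0 := by
        rw [← transpose_transpose (rowBlk Y j), ← transpose_mul, h, transpose_zero]
      rw [h, h', add_zero]
    · simp [hYj j hj]
  rw [Finset.sum_eq_single i
      (fun j _ hj => Finset.sum_eq_zero fun l _ => by simp [hYj j hj, finner]) (by simp),
    Finset.sum_eq_single i (fun j _ hj => by simp [hYj j hj, finner]) (by simp),
    Finset.sum_eq_single i (fun j _ hj => by simp [hYj j hj, finner]) (by simp),
    hYi, finner_vecMulVec_mul_transpose, finner_vecMulVec_mul_transpose, hAi, one_mulVec] at key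
  have huu : 0 < u ⬝ᵥ u :=
    lt_of_le_of_ne (Finset.sum_nonneg fun _ _ => mul_self_nonneg _)
      fun h => hu0 (dotProduct_self_eq_zero.1 h.symm)
  have hxx : 0 ≤ x ⬝ᵥ x := Finset.sum_nonneg fun _ _ => mul_self_nonneg _
  exact hxx.trans (le_of_mul_le_mul_right key huu)

theorem sub_frobNorm_sq_div_two_sub_opNorm_le_eigenvalue
    {Δ A : Matrix (Fin n × Fin d) (Fin n × Fin d) ℝ} (hΔdiag : ∀ i, blk Δ i i = 0)
    (hA : A.IsSymm) (hAblk : ∀ i j, blk A i j = 1 + blk Δ i j)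
    {S : Matrix (Fin n × Fin d) (Fin p) ℝ} (hS : StiefelBlocks S) (hcrit : firstOrderCrit A S)
    {i : Fin n} {y : Fin d → ℝ} {c : ℝ} (hy : y ⬝ᵥ y = 1) (hc : Lam A S i *ᵥ y = c • y)
    (hc0 : 0 ≤ c) {Q : Matrix (Fin d) (Fin p) ℝ} (hQ : Q * Qᵀ = 1) :
    n - frobNorm (S - Zmat n d * Q) ^ 2 / 2
      - opNorm (∑ j ∈ Finset.univ.erase i, blk Δ i j * rowBlk S j) ≤ c := by
  set E := ∑ j ∈ Finset.univ.erase i, blk Δ i j * rowBlk S j with hE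
  set q := y ᵥ* Q
  set s : Fin n → Fin p → ℝ := fun j => y ᵥ* rowBlk S j with hs
  have hqq : q ⬝ᵥ q = 1 := (vecMul_dotProduct_vecMul_self hQ y).trans hy
  have hss : ∀ j, s j ⬝ᵥ s j = 1 := fun j => (vecMul_dotProduct_vecMul_self (hS j) y).trans hy
  have hsub : ∀ j, (s j - q) ⬝ᵥ (s j - q) = 2 - 2 * (s j ⬝ᵥ q) := fun j => by
    rw [sub_dotProduct, dotProduct_sub, dotProduct_sub, hqq, hss, dotProduct_comm q]
    ring
  have hcritE : ∑ j, rowBlk S j + E = Lam A S i * rowBlk S i := by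
    rw [← hcrit i, hE, Finset.sum_erase _ (by rw [hΔdiag, Matrix.zero_mul]),
      ← Finset.sum_add_distrib]
    exact Finset.sum_congr rfl fun j _ => by rw [hAblk, Matrix.add_mul, Matrix.one_mul]
  have hpair : ∑ j, s j ⬝ᵥ q + y ⬝ᵥ E *ᵥ q = c * (s i ⬝ᵥ q) := by
    have h := congrArg (fun M => y ᵥ* M ⬝ᵥ q) hcritE
    have hyL : y ᵥ* Lam A S i = c • y := by
      rw [← hc, ← mulVec_transpose, (Lam_isSymm hA S i).eq]
    simp only [vecMul_add, add_dotProduct, ← vecMul_vecMul, hyL, smul_vecMul, smul_dotProduct,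
      smul_eq_mul, vecMul_sum, sum_dotProduct] at h
    rw [dotProduct_mulVec]
    exact h
  have hfrob : ∑ j, (s j - q) ⬝ᵥ (s j - q) ≤ frobNorm (S - Zmat n d * Q) ^ 2 := by
    refine le_trans (le_of_eq ?_) (sum_vecMul_rowBlk_sq_le_frobNorm_sq (S - Zmat n d * Q) hy)
    exact Finset.sum_congr rfl fun j _ => by rw [rowBlk_sub_Zmat_mul, vecMul_sub]
  simp only [hsub, Finset.sum_sub_distrib, ← Finset.mul_sum, Finset.sum_const, Finset.card_univ,
    Fintype.card_fin, nsmul_eq_mul] at hfrob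
  have hEq := (abs_le.1 (abs_dotProduct_mulVec_le E hy hqq)).1
  have hsq : s i ⬝ᵥ q ≤ 1 := by
    have h : 0 ≤ (s i - q) ⬝ᵥ (s i - q) := Finset.sum_nonneg fun _ _ => mul_self_nonneg _
    rw [hsub] at h
    linarith
  nlinarith [mul_le_mul_of_nonneg_left hsq hc0]

end Blocks

/-- eigenvalue lower bound for `Λ_{ii}(S)` at second-order critical points
satisfying the proximity condition (Lemma 5.6). Part (i) is expressed through the
quadratic form: for a symmetric matrix, `λ_min(Λ) ≥ β` iff `β‖x‖² ≤ xᵀΛx` for all x. -/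
theorem Lam_eigenvalue_bound {n d p : ℕ} (hn : 2 ≤ n) (hd : 1 ≤ d) (hp : d + 1 ≤ p)
    (Δ : Matrix (Fin n × Fin d) (Fin n × Fin d) ℝ)
    (hΔsym : Δ.IsSymm) (hΔdiag : ∀ i, blk Δ i i = 0)
    (A : Matrix (Fin n × Fin d) (Fin n × Fin d) ℝ)
    (hA : A = Zmat n d * (Zmat n d)ᵀ + Δ)
    (δ : ℝ) (hδ : 0 < δ)
    (S : Matrix (Fin n × Fin d) (Fin p) ℝ) (hS : secondOrderCrit A S)
    (hprox : dF S ≤ δ * Real.sqrt ((d : ℝ) / n) * opNorm Δ) :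
    (∀ i : Fin n, ∀ x : Fin d → ℝ,
      ((n : ℝ) - δ ^ 2 * d * opNorm Δ ^ 2 / (2 * n)
          - (⨆ k : Fin n, opNorm (∑ j ∈ Finset.univ.erase k, blk Δ k j * rowBlk S j)))
        * (∑ m, x m ^ 2) ≤ x ⬝ᵥ (Lam A S i).mulVec x) ∧
    (⨆ i : Fin n, opNorm (∑ j ∈ Finset.univ.erase i, blk Δ i j * rowBlk S j)) ≤
      δ * Real.sqrt ((d : ℝ) / n) * opNorm Δ * (⨆ i, opNorm (colBlk Δ i))
      + (⨆ i, opNorm ((colBlk Δ i)ᵀ * Zmat n d)) := by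
  obtain ⟨hSt, hcrit, hsec⟩ := hS
  have hn0 : 0 < n := by omega
  have hnR : (0 : ℝ) < n := Nat.cast_pos.2 hn0
  set r := δ * Real.sqrt ((d : ℝ) / n) * opNorm Δ with hr
  have hr0 : 0 ≤ r := mul_nonneg (by positivity) (opNorm_nonneg Δ)
  have hr2 : r ^ 2 / 2 = δ ^ 2 * d * opNorm Δ ^ 2 / (2 * n) := by
    rw [hr, mul_pow, mul_pow, Real.sq_sqrt (by positivity)]
    field_simp
  have hAsym : A.IsSymm := by
    rw [IsSymm, hA, transpose_add, transpose_mul, transpose_transpose, hΔsym.eq]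
  have hAblk : ∀ i j, blk A i j = 1 + blk Δ i j := fun i j => by
    rw [hA, blk_Zmat_mul_transpose_add]
  have le_sup : ∀ (g : Fin n → ℝ) (i : Fin n), g i ≤ ⨆ k, g k := fun g i =>
    le_ciSup (Set.finite_range g).bddAbove i
  refine ⟨fun i x => ?_, ?_⟩
  · refine mul_sum_sq_le_of_eigenvalue_ge (Lam_isSymm hAsym S i) (fun y c hy hc => ?_) x
    have hc0 : 0 ≤ c := by
      have h := Lam_quadratic_form_nonneg (by omega) hsec
        (by rw [hAblk, hΔdiag, add_zero] : blk A i i = 1) y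
      rwa [hc, dotProduct_smul, hy, smul_eq_mul, mul_one] at h
    have hE := le_sup (fun k => opNorm (∑ j ∈ Finset.univ.erase k, blk Δ k j * rowBlk S j)) i
    have hT : Real.sqrt (2 * (n - opNorm (∑ j ∈ Finset.univ.erase i, blk Δ i j * rowBlk S j) - c))
        ≤ r := by
      refine le_trans (le_dF hn0 hSt fun Q hQ => Real.sqrt_le_iff.2 ⟨Real.sqrt_nonneg _, ?_⟩) hprox
      have := sub_frobNorm_sq_div_two_sub_opNorm_le_eigenvalue hΔdiag hAsym hAblk hSt hcrit
        hy hc hc0 hQ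
      linarith
    have := (Real.sqrt_le_iff.1 hT).2
    rw [← hr2]
    linarith
  · have : Nonempty (Fin n) := ⟨⟨0, hn0⟩⟩
    refine ciSup_le fun i => ?_
    rw [sum_erase_blk_mul_rowBlk hΔsym hΔdiag]
    have hQ : ∀ Q : Matrix (Fin d) (Fin p) ℝ, Q * Qᵀ = 1 → opNorm ((colBlk Δ i)ᵀ * S) ≤
        frobNorm (S - Zmat n d * Q) * opNorm (colBlk Δ i) + opNorm ((colBlk Δ i)ᵀ * Zmat n d) := by
      intro Q hQ
      have hsplit : (colBlk Δ i)ᵀ * S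
          = (colBlk Δ i)ᵀ * (S - Zmat n d * Q) + (colBlk Δ i)ᵀ * Zmat n d * Q := by
        rw [Matrix.mul_sub, Matrix.mul_assoc, sub_add_cancel]
      rw [hsplit]
      refine (opNorm_add_le _ _).trans (add_le_add ?_ ?_)
      · refine (opNorm_mul_le _ _).trans ?_
        rw [opNorm_transpose, mul_comm]
        exact mul_le_mul_of_nonneg_right (opNorm_le_frobNorm _) (opNorm_nonneg _)
      · exact (opNorm_mul_le _ _).trans (mul_le_of_le_one_right (opNorm_nonneg _)
          (opNorm_le_one_of_mul_transpose_eq_one hQ))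
    have hi : opNorm ((colBlk Δ i)ᵀ * S) ≤
        r * opNorm (colBlk Δ i) + opNorm ((colBlk Δ i)ᵀ * Zmat n d) := by
      rcases (opNorm_nonneg (colBlk Δ i)).eq_or_lt with h0 | h0
      · simpa [← h0] using hQ _ (hSt i)
      · have := (le_dF hn0 hSt fun Q h => (div_le_iff₀ h0).2
          (sub_le_iff_le_add.2 (hQ Q h))).trans hprox
        exact sub_le_iff_le_add.1 ((div_le_iff₀ h0).1 this)
    exact hi.trans (add_le_add
      (mul_le_mul_of_nonneg_left (le_sup (fun i => opNorm (colBlk Δ i)) i) hr0)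
      (le_sup (fun i => opNorm ((colBlk Δ i)ᵀ * Zmat n d)) i))
end
end

section
/- Let S ∈ St(d,p)^{⊗n} be a first-order critical point of f, i.e. Σ_{j=1}^n A_{ij} S_j = Λ_{ii}(S) S_i for every i. Then ‖SSᵀ‖_F² ≥ ‖ZᵀS‖_F² − (1/n)·‖ΔS‖_F², where ΔS ∈ ℝ^{nd×p} is the matrix product of Δ and S. -/
open Matrix MeasureTheory ProbabilityTheory
open scoped BigOperators ENNReal

noncomputable section

theorem frobNorm_sq_eq_trace {m k : Type*} [Fintype m] [Fintype k] (X : Matrix m k ℝ) :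
    frobNorm X ^ 2 = (X * Xᵀ).trace := by
  rw [frobNorm_sq]
  simp [Matrix.trace, Matrix.mul_apply, sq]

theorem frobNorm_transpose_sq {m k : Type*} [Fintype m] [Fintype k] (X : Matrix m k ℝ) :
    frobNorm Xᵀ ^ 2 = frobNorm X ^ 2 := by
  simp only [frobNorm_sq, Matrix.transpose_apply]
  exact Finset.sum_comm

theorem frobNorm_sq_eq_sum_rowBlk {n d p : ℕ} (M : Matrix (Fin n × Fin d) (Fin p) ℝ) :
    frobNorm M ^ 2 = ∑ i, frobNorm (rowBlk M i) ^ 2 := by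
  simp only [frobNorm_sq, rowBlk, Fintype.sum_prod_type]

theorem rowBlk_mul {n d p k : ℕ} (S : Matrix (Fin n × Fin d) (Fin p) ℝ)
    (X : Matrix (Fin p) (Fin k) ℝ) (i : Fin n) : rowBlk (S * X) i = rowBlk S i * X :=
  rfl

theorem rowBlk_mul_eq_sum_blk {n d p : ℕ} (M : Matrix (Fin n × Fin d) (Fin n × Fin d) ℝ)
    (S : Matrix (Fin n × Fin d) (Fin p) ℝ) (i : Fin n) :
    rowBlk (M * S) i = ∑ j, blk M i j * rowBlk S j := by
  ext a b
  simp [rowBlk, blk, Matrix.mul_apply, Matrix.sum_apply, Fintype.sum_prod_type]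

theorem rowBlk_Zmat {n d : ℕ} (i : Fin n) : rowBlk (Zmat n d) i = 1 := by
  ext a b
  simp [rowBlk, Zmat, Matrix.one_apply]

theorem Zmat_transpose_mul_apply {n d : ℕ} {k : Type*} (M : Matrix (Fin n × Fin d) k ℝ)
    (a : Fin d) (b : k) : ((Zmat n d)ᵀ * M) a b = ∑ i, M (i, a) b := by
  simp [Zmat, Matrix.mul_apply, Fintype.sum_prod_type]

theorem frobNorm_Zmat_transpose_mul_sq_le {n d : ℕ} {k : Type*} [Fintype k]
    (M : Matrix (Fin n × Fin d) k ℝ) :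
    frobNorm ((Zmat n d)ᵀ * M) ^ 2 ≤ n * frobNorm M ^ 2 := by
  simp only [frobNorm_sq, Zmat_transpose_mul_apply]
  calc ∑ a, ∑ b, (∑ i, M (i, a) b) ^ 2
      ≤ ∑ a, ∑ b, (n : ℝ) * ∑ i, M (i, a) b ^ 2 := by
        gcongr with a _ b _
        simpa using sq_sum_le_card_mul_sum_sq (s := Finset.univ) (f := fun i => M (i, a) b)
    _ = n * ∑ q, ∑ b, M q b ^ 2 := by
        simp only [← Finset.mul_sum, Fintype.sum_prod_type]
        rw [Finset.sum_comm (s := (Finset.univ : Finset (Fin n)))]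
        congr 1
        exact Finset.sum_congr rfl fun _ _ => Finset.sum_comm

/-- Pythagoras for the projection of `G` onto the row space of `S`. -/
theorem frobNorm_mul_sub_sq {m d k : Type*} [Fintype m] [Fintype d] [DecidableEq d] [Fintype k]
    (G : Matrix m k ℝ) (L : Matrix m d ℝ) (S : Matrix d k ℝ) (hS : S * Sᵀ = 1) :
    frobNorm (L * S - G) ^ 2 =
      frobNorm G ^ 2 - frobNorm (G * Sᵀ) ^ 2 + frobNorm (L - G * Sᵀ) ^ 2 := by
  have hLL : L * S * (L * S)ᵀ = L * Lᵀ := by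
    rw [Matrix.transpose_mul, Matrix.mul_assoc, ← Matrix.mul_assoc S, hS, Matrix.one_mul]
  have hGL : G * (L * S)ᵀ = G * Sᵀ * Lᵀ := by
    rw [Matrix.transpose_mul, Matrix.mul_assoc]
  have hLG : L * S * Gᵀ = L * (G * Sᵀ)ᵀ := by
    rw [Matrix.transpose_mul, Matrix.transpose_transpose, Matrix.mul_assoc]
  simp only [frobNorm_sq_eq_trace, Matrix.transpose_sub, Matrix.sub_mul, Matrix.mul_sub,
    Matrix.trace_sub, hLL, hGL, hLG]
  ring

/-- consequence of the first-order condition (Lemma 5.11). -/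
theorem first_order_inequality {n d p : ℕ} (hn : 2 ≤ n) (hd : 1 ≤ d) (hp : d ≤ p)
    (Δ : Matrix (Fin n × Fin d) (Fin n × Fin d) ℝ)
    (hΔsym : Δ.IsSymm) (hΔdiag : ∀ i, blk Δ i i = 0)
    (A : Matrix (Fin n × Fin d) (Fin n × Fin d) ℝ)
    (hA : A = Zmat n d * (Zmat n d)ᵀ + Δ)
    (S : Matrix (Fin n × Fin d) (Fin p) ℝ) (hS : StiefelBlocks S)
    (h1 : firstOrderCrit A S) :
    frobNorm (S * Sᵀ) ^ 2 ≥
      frobNorm ((Zmat n d)ᵀ * S) ^ 2 - (1 / (n : ℝ)) * frobNorm (Δ * S) ^ 2 := by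
  have hn0 : (0 : ℝ) < n := by exact_mod_cast (by omega : 0 < n)
  set G := (Zmat n d)ᵀ * S with hG
  have hblock (i : Fin n) : rowBlk (Δ * S) i = Lam A S i * rowBlk S i - G := by
    rw [← h1 i, ← rowBlk_mul_eq_sum_blk, hA, Matrix.add_mul, Matrix.mul_assoc, ← hG]
    have hZ : rowBlk (Zmat n d * G) i = G := by rw [rowBlk_mul, rowBlk_Zmat, Matrix.one_mul]
    rw [eq_sub_iff_add_eq']
    nth_rw 1 [← hZ]
    rfl
  have hGS : frobNorm (G * Sᵀ) ^ 2 = ∑ i, frobNorm (G * (rowBlk S i)ᵀ) ^ 2 := by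
    rw [← frobNorm_transpose_sq, Matrix.transpose_mul, Matrix.transpose_transpose,
      frobNorm_sq_eq_sum_rowBlk]
    refine Finset.sum_congr rfl fun i _ => ?_
    rw [rowBlk_mul, ← frobNorm_transpose_sq, Matrix.transpose_mul, Matrix.transpose_transpose]
  have hlow : n * frobNorm G ^ 2 - frobNorm (G * Sᵀ) ^ 2 ≤ frobNorm (Δ * S) ^ 2 := by
    calc n * frobNorm G ^ 2 - frobNorm (G * Sᵀ) ^ 2
        = ∑ i, (frobNorm G ^ 2 - frobNorm (G * (rowBlk S i)ᵀ) ^ 2) := by simp [hGS]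
      _ ≤ ∑ i, frobNorm (rowBlk (Δ * S) i) ^ 2 := by
          refine Finset.sum_le_sum fun i _ => ?_
          rw [hblock, frobNorm_mul_sub_sq _ _ _ (hS i)]
          exact le_add_of_nonneg_right (sq_nonneg _)
      _ = frobNorm (Δ * S) ^ 2 := (frobNorm_sq_eq_sum_rowBlk _).symm
  have hup : frobNorm (G * Sᵀ) ^ 2 ≤ n * frobNorm (S * Sᵀ) ^ 2 := by
    rw [hG, Matrix.mul_assoc]
    exact frobNorm_Zmat_transpose_mul_sq_le _
  have hsum : frobNorm G ^ 2 * n ≤ n * frobNorm (S * Sᵀ) ^ 2 + frobNorm (Δ * S) ^ 2 := by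
    linarith
  rw [ge_iff_le, sub_le_iff_le_add]
  refine ((le_div_iff₀ hn0).2 hsum).trans_eq ?_
  field_simp
end
end

section
/- Let N ≥ 1 and p ≥ 1 be integers, let X ∈ ℝ^{N×N} be symmetric, and let S ∈ ℝ^{N×p} be a matrix each of whose rows has unit Euclidean norm (equivalently, all diagonal entries of SSᵀ equal 1). Then the Hadamard (entrywise) product satisfies ‖X ∘ (SSᵀ)‖_op ≤ ‖X‖_op. -/
open Matrix MeasureTheory ProbabilityTheory
open scoped BigOperators ENNReal

noncomputable section

lemma inner_toEuclideanLin_eq_sum {m k : Type*} [Fintype m] [Fintype k] [DecidableEq k]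
    (X : Matrix m k ℝ) (x : EuclideanSpace ℝ k) (y : EuclideanSpace ℝ m) :
    inner ℝ (Matrix.toEuclideanLin X x) y = ∑ i, ∑ j, X i j * x j * y i := by
  simp only [PiLp.inner_apply, Matrix.toLpLin_apply, Matrix.mulVec, dotProduct,
    RCLike.inner_apply, conj_trivial, Finset.mul_sum]
  exact Finset.sum_congr rfl fun i _ => Finset.sum_congr rfl fun j _ => by ring

lemma sum_mul_mul_le_opNorm {m k : Type*} [Fintype m] [Fintype k] [DecidableEq k]
    (X : Matrix m k ℝ) (x : EuclideanSpace ℝ k) (y : EuclideanSpace ℝ m) :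
    ∑ i, ∑ j, X i j * x j * y i ≤ opNorm X * (‖x‖ * ‖y‖) := by
  rw [← inner_toEuclideanLin_eq_sum, ← mul_assoc]
  exact (real_inner_le_norm _ _).trans (mul_le_mul_of_nonneg_right
    ((LinearMap.toContinuousLinearMap (Matrix.toEuclideanLin X)).le_opNorm x) (norm_nonneg y))

/-- The pieces `x ∘ S_k`, for the columns `S_k` of a matrix with unit rows, split `‖x‖²`. -/
lemma sum_norm_sq_column_mul {m l : Type*} [Fintype m] [Fintype l] (S : Matrix m l ℝ)
    (hS : ∀ i, ∑ k, (S i k) ^ 2 = 1) (x : EuclideanSpace ℝ m) :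
    ∑ k, ‖WithLp.toLp 2 fun i => S i k * x i‖ ^ 2 = ‖x‖ ^ 2 := by
  simp only [EuclideanSpace.real_norm_sq_eq, mul_pow]
  rw [Finset.sum_comm]
  simp only [← Finset.sum_mul, hS, one_mul]

lemma opNorm_hadamard_mul_transpose_le {m k l : Type*} [Fintype m] [Fintype k] [Fintype l]
    [DecidableEq k] (X : Matrix m k ℝ) (S : Matrix m l ℝ) (T : Matrix k l ℝ)
    (hS : ∀ i, ∑ r, (S i r) ^ 2 = 1) (hT : ∀ j, ∑ r, (T j r) ^ 2 = 1) :
    opNorm (Matrix.hadamard X (S * Tᵀ)) ≤ opNorm X := by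
  have hX : 0 ≤ opNorm X := norm_nonneg _
  refine ContinuousLinearMap.opNorm_le_of_re_inner_le hX fun x y hx hy => ?_
  let u : l → EuclideanSpace ℝ k := fun r => WithLp.toLp 2 fun j => T j r * x j
  let v : l → EuclideanSpace ℝ m := fun r => WithLp.toLp 2 fun i => S i r * y i
  have hu : ∑ r, ‖u r‖ ^ 2 = ‖x‖ ^ 2 := sum_norm_sq_column_mul T hT x
  have hv : ∑ r, ‖v r‖ ^ 2 = ‖y‖ ^ 2 := sum_norm_sq_column_mul S hS y
  calc inner ℝ (Matrix.toEuclideanLin (Matrix.hadamard X (S * Tᵀ)) x) y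
      = ∑ r, ∑ i, ∑ j, X i j * u r j * v r i := by
        simp only [inner_toEuclideanLin_eq_sum, Finset.sum_comm (s := (Finset.univ : Finset l))]
        refine Finset.sum_congr rfl fun i _ => Finset.sum_congr rfl fun j _ => ?_
        simp only [Matrix.hadamard_apply, Matrix.mul_apply, Matrix.transpose_apply,
          Finset.mul_sum, Finset.sum_mul, u, v]
        exact Finset.sum_congr rfl fun r _ => by ring
    _ ≤ ∑ r, opNorm X * (‖u r‖ * ‖v r‖) :=
        Finset.sum_le_sum fun r _ => sum_mul_mul_le_opNorm X (u r) (v r)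
    _ = opNorm X * ∑ r, ‖u r‖ * ‖v r‖ := by rw [Finset.mul_sum]
    _ ≤ opNorm X * 1 := by
        refine mul_le_mul_of_nonneg_left ?_ hX
        simpa [hu, hv, hx, hy] using Real.sum_mul_le_sqrt_mul_sqrt Finset.univ
          (fun r => ‖u r‖) (fun r => ‖v r‖)
    _ = opNorm X := mul_one _

/-- the Hadamard product bound `‖X ∘ SSᵀ‖_op ≤ ‖X‖_op` (Lemma 5.12). -/
theorem hadamard_opNorm_bound {N p : ℕ} (hN : 1 ≤ N) (hp : 1 ≤ p)
    (X : Matrix (Fin N) (Fin N) ℝ) (hX : X.IsSymm)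
    (S : Matrix (Fin N) (Fin p) ℝ) (hrow : ∀ i, ∑ j, (S i j) ^ 2 = 1) :
    opNorm (Matrix.hadamard X (S * Sᵀ)) ≤ opNorm X := by
  exact opNorm_hadamard_mul_transpose_le X S S hrow hrow
end
end
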